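/- Let O be an ontology whose concepts are ALCι_L concepts, and let O' be obtained from O by repeatedly replacing an innermost occurrence of a local definite description {ιC} (where C contains no definite descriptions) by A_C ⊓ (ι A_C.⊤), where A_C is a fresh atomic concept name not occurring in O or in previously introduced axioms, and adding the concept inclusions A_C ⊑ C and C ⊑ A_C, until no local definite descriptions remain (so O' is an ALCι_G ontology). Then: (i) every model of O' is a model of O; (ii) every model of O can be turned into a model of O' by changing only the extensions of the fresh atomic concepts A_C. Consequently, O is satisfiable if and only if O' is satisfiable, and O' is a conservative extension of O. -/

import Mathlib

universe u

namespace DL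

/-- ALCι concepts, with atomic concept names and role names both drawn from
the countably infinite (and disjoint, being distinct sorts) sets `ℕ`. -/
inductive Concept : Type
  | atom : ℕ → Concept
  | neg : Concept → Concept
  | conj : Concept → Concept → Concept
  | ex : ℕ → Concept → Concept
  | iotaL : Concept → Concept
  | iotaG : Concept → Concept → Concept
  deriving DecidableEq

/-- An interpretation with (nonempty) domain `D`; individual names are also
drawn from `ℕ`. -/
structure Interp (D : Type u) where
  atomI : ℕ → Set D
  roleI : ℕ → Set (D × D)
  indI : ℕ → D

/-- The extension `C^I` of a concept `C` in the interpretation `I`. -/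
def Interp.sem {D : Type u} (I : Interp D) : Concept → Set D
  | .atom A => I.atomI A
  | .neg C => (I.sem C)ᶜ
  | .conj C D' => I.sem C ∩ I.sem D'
  | .ex r C => {d | ∃ e, (d, e) ∈ I.roleI r ∧ e ∈ I.sem C}
  | .iotaL C => {d | I.sem C = {d}}
  | .iotaG C D' => {_d | ∃ e, I.sem C = {e} ∧ e ∈ I.sem D'}

/-- Concepts not using the global definite description constructor `ιC.D`,
i.e. ALCι_L concepts. -/
def Concept.noG : Concept → Prop
  | .atom _ => True
  | .neg C => C.noG
  | .conj C D => C.noG ∧ D.noG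
  | .ex _ C => C.noG
  | .iotaL C => C.noG
  | .iotaG _ _ => False

/-- Concepts not using the local definite description constructor `{ιC}`,
i.e. ALCι_G concepts. -/
def Concept.noL : Concept → Prop
  | .atom _ => True
  | .neg C => C.noL
  | .conj C D => C.noL ∧ D.noL
  | .ex _ C => C.noL
  | .iotaL _ => False
  | .iotaG C D => C.noL ∧ D.noL

/-- Concepts containing no definite descriptions at all. -/
def Concept.ddFree : Concept → Prop
  | .atom _ => True
  | .neg C => C.ddFree
  | .conj C D => C.ddFree ∧ D.ddFree
  | .ex _ C => C.ddFree
  | .iotaL _ => False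
  | .iotaG _ _ => False

/-- `⊤ := ¬(A ⊓ ¬A)` for a fixed atomic concept name. -/
def top : Concept := .neg (.conj (.atom 0) (.neg (.atom 0)))

/-- Axioms: concept inclusions `C ⊑ D`, concept assertions `a : C` and role
assertions `r : (a, b)`. -/
inductive Ax : Type
  | sub : Concept → Concept → Ax
  | mem : ℕ → Concept → Ax
  | rel : ℕ → ℕ → ℕ → Ax
  deriving DecidableEq

/-- Satisfaction of an axiom in an interpretation. -/
def Interp.satAx {D : Type u} (I : Interp D) : Ax → Prop
  | .sub C C' => I.sem C ⊆ I.sem C'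
  | .mem a C => I.indI a ∈ I.sem C
  | .rel r a b => (I.indI a, I.indI b) ∈ I.roleI r

/-- All concepts of an axiom are ALCι_L concepts. -/
def axNoG : Ax → Prop
  | .sub C C' => C.noG ∧ C'.noG
  | .mem _ C => C.noG
  | .rel _ _ _ => True

/-- All concepts of an axiom are ALCι_G concepts (no local DDs remain). -/
def axNoL : Ax → Prop
  | .sub C C' => C.noL ∧ C'.noL
  | .mem _ C => C.noL
  | .rel _ _ _ => True

/-- The atomic concept names occurring in a concept. -/
def conceptNames : Concept → Finset ℕ
  | .atom A => {A}
  | .neg C => conceptNames C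
  | .conj C D => conceptNames C ∪ conceptNames D
  | .ex _ C => conceptNames C
  | .iotaL C => conceptNames C
  | .iotaG C D => conceptNames C ∪ conceptNames D

/-- The atomic concept names occurring in an axiom. -/
def axNames : Ax → Finset ℕ
  | .sub C C' => conceptNames C ∪ conceptNames C'
  | .mem _ C => conceptNames C
  | .rel _ _ _ => ∅

/-- `ReplStep A C X X'` holds iff `X'` is obtained from `X` by replacing one
(innermost) occurrence of the local definite description `{ιC}`, where `C`
contains no definite descriptions, by `A ⊓ (ι A.⊤)` for the atomic concept
name `A`. -/
inductive ReplStep (A : ℕ) (C : Concept) : Concept → Concept → Prop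
  | here : C.ddFree →
      ReplStep A C (.iotaL C) (.conj (.atom A) (.iotaG (.atom A) top))
  | negC {X X'} : ReplStep A C X X' → ReplStep A C (.neg X) (.neg X')
  | conjL {X X' Y} : ReplStep A C X X' → ReplStep A C (.conj X Y) (.conj X' Y)
  | conjR {X Y Y'} : ReplStep A C Y Y' → ReplStep A C (.conj X Y) (.conj X Y')
  | exC {r X X'} : ReplStep A C X X' → ReplStep A C (.ex r X) (.ex r X')
  | iotaLC {X X'} : ReplStep A C X X' → ReplStep A C (.iotaL X) (.iotaL X')
  | iotaGL {X X' Y} : ReplStep A C X X' → ReplStep A C (.iotaG X Y) (.iotaG X' Y)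
  | iotaGR {X Y Y'} : ReplStep A C Y Y' → ReplStep A C (.iotaG X Y) (.iotaG X Y')

/-- Lifting of `ReplStep` to axioms. -/
inductive ReplStepAx (A : ℕ) (C : Concept) : Ax → Ax → Prop
  | subL {X X' Y} : ReplStep A C X X' → ReplStepAx A C (.sub X Y) (.sub X' Y)
  | subR {X Y Y'} : ReplStep A C Y Y' → ReplStepAx A C (.sub X Y) (.sub X Y')
  | mem {a X X'} : ReplStep A C X X' → ReplStepAx A C (.mem a X) (.mem a X')

/-- One step of the ontology transformation: pick an axiom `ax` of the current
ontology, replace in it an innermost occurrence of a local definite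
description `{ιC}` (with `C` free of definite descriptions) by
`A ⊓ (ι A.⊤)` for a fresh atomic concept name `A` (not occurring in the
current ontology, hence not in the original ontology nor in previously
introduced axioms), and add the concept inclusions `A ⊑ C` and `C ⊑ A`. -/
inductive OntStep : Finset Ax → Finset Ax → Prop
  | step (O : Finset Ax) (A : ℕ) (C : Concept) (ax ax' : Ax)
      (hax : ax ∈ O)
      (hrep : ReplStepAx A C ax ax')
      (hfresh : ∀ b ∈ O, A ∉ axNames b) :
      OntStep O (insert ax' (insert (.sub (.atom A) C)
        (insert (.sub C (.atom A)) (O.erase ax))))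

/-- `A` occurs as an atomic concept name in some axiom of `O`. -/
def OccursIn (O : Finset Ax) (A : ℕ) : Prop := ∃ ax ∈ O, A ∈ axNames ax

lemma sem_congr {D : Type u} {I J : Interp D} (hr : J.roleI = I.roleI) (X : Concept)
    (h : ∀ A ∈ conceptNames X, J.atomI A = I.atomI A) : J.sem X = I.sem X := by
  induction X with
  | atom A => exact h A (by simp [conceptNames])
  | neg X ih => simp only [Interp.sem, ih h]
  | ex r X ih => simp only [Interp.sem, ih h, hr]
  | iotaL X ih => simp only [Interp.sem, ih h]
  | conj X Y ihX ihY | iotaG X Y ihX ihY =>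
    simp only [Interp.sem, ihX fun A hA => h A (Finset.mem_union_left _ hA),
      ihY fun A hA => h A (Finset.mem_union_right _ hA)]

lemma satAx_congr {D : Type u} {I J : Interp D} (hr : J.roleI = I.roleI)
    (hi : J.indI = I.indI) (ax : Ax) (h : ∀ A ∈ axNames ax, J.atomI A = I.atomI A) :
    J.satAx ax ↔ I.satAx ax := by
  cases ax with
  | sub X Y =>
    simp only [Interp.satAx, sem_congr hr X fun A hA => h A (Finset.mem_union_left _ hA),
      sem_congr hr Y fun A hA => h A (Finset.mem_union_right _ hA)]
  | mem a X => simp only [Interp.satAx, sem_congr hr X h, hi]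
  | rel r a b => simp only [Interp.satAx, hr, hi]

lemma sem_top {D : Type u} (I : Interp D) : I.sem top = Set.univ := by
  simp [top, Interp.sem]

lemma ReplStep.sem_eq {A : ℕ} {C X X' : Concept} (h : ReplStep A C X X') {D : Type u}
    (I : Interp D) (hA : I.atomI A = I.sem C) : I.sem X' = I.sem X := by
  induction h with
  | here _ =>
    ext d
    simp only [Interp.sem, sem_top, hA, Set.mem_inter_iff, Set.mem_ofPred_eq, Set.mem_univ,
      and_true]
    constructor
    · rintro ⟨hd, e, he⟩
      rw [he] at hd ⊢
      rw [Set.mem_singleton_iff.mp hd]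
    · intro hd
      exact ⟨by rw [hd]; rfl, d, hd⟩
  | _ => simp only [Interp.sem, *]

lemma ReplStepAx.satAx_iff {A : ℕ} {C : Concept} {ax ax' : Ax} (h : ReplStepAx A C ax ax')
    {D : Type u} (I : Interp D) (hA : I.atomI A = I.sem C) : I.satAx ax' ↔ I.satAx ax := by
  cases h with
  | subL h | subR h | mem h => simp only [Interp.satAx, h.sem_eq I hA]

lemma ReplStep.conceptNames_subset {A : ℕ} {C X X' : Concept} (h : ReplStep A C X X') :
    conceptNames C ⊆ conceptNames X := by
  induction h with
  | here _ => exact subset_rfl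
  | negC _ ih | exC _ ih | iotaLC _ ih => exact ih
  | conjL _ ih | iotaGL _ ih => exact ih.trans Finset.subset_union_left
  | conjR _ ih | iotaGR _ ih => exact ih.trans Finset.subset_union_right

lemma ReplStepAx.conceptNames_subset {A : ℕ} {C : Concept} {ax ax' : Ax}
    (h : ReplStepAx A C ax ax') : conceptNames C ⊆ axNames ax := by
  cases h with
  | subL h => exact h.conceptNames_subset.trans Finset.subset_union_left
  | subR h => exact h.conceptNames_subset.trans Finset.subset_union_right
  | mem h => exact h.conceptNames_subset

lemma ReplStep.names_subset_union {A : ℕ} {C X X' : Concept} (h : ReplStep A C X X') :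
    conceptNames X ⊆ conceptNames X' ∪ conceptNames C := by
  induction h with
  | here _ => exact Finset.subset_union_right
  | negC _ ih | exC _ ih | iotaLC _ ih => exact ih
  | conjL _ ih | conjR _ ih | iotaGL _ ih | iotaGR _ ih =>
    intro B hB
    have := @ih B
    simp only [conceptNames, Finset.mem_union] at *
    tauto

lemma ReplStepAx.names_subset_union {A : ℕ} {C : Concept} {ax ax' : Ax}
    (h : ReplStepAx A C ax ax') : axNames ax ⊆ axNames ax' ∪ conceptNames C := by
  cases h with
  | subL h | subR h | mem h =>
    intro B hB
    have hsub := h.names_subset_union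
    have := @hsub B
    simp only [axNames, Finset.mem_union] at *
    tauto

/-- `I` and `J` differ at most in the extensions of the atomic concept names that occur in `O'`
but not in `O`. -/
structure AgreeOffNew {D : Type u} (O O' : Finset Ax) (I J : Interp D) : Prop where
  roleI_eq : J.roleI = I.roleI
  indI_eq : J.indI = I.indI
  atomI_eq : ∀ A, ¬(OccursIn O' A ∧ ¬OccursIn O A) → J.atomI A = I.atomI A

/-- `O'` is a model-conservative extension of `O`. -/
structure ModelConservative (O O' : Finset Ax) : Prop where
  names : ∀ A, OccursIn O A → OccursIn O' A
  model : ∀ (D : Type u) (I : Interp D), (∀ ax ∈ O', I.satAx ax) → ∀ ax ∈ O, I.satAx ax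
  expand : ∀ (D : Type u) (I : Interp D), (∀ ax ∈ O, I.satAx ax) →
    ∃ J : Interp D, (∀ ax ∈ O', J.satAx ax) ∧ AgreeOffNew O O' I J

lemma ModelConservative.refl (O : Finset Ax) : ModelConservative.{u} O O where
  names _ h := h
  model _ _ h := h
  expand _ I h := ⟨I, h, rfl, rfl, fun _ _ => rfl⟩

lemma ModelConservative.trans {O₁ O₂ O₃ : Finset Ax} (h : ModelConservative.{u} O₁ O₂)
    (h' : ModelConservative.{u} O₂ O₃) : ModelConservative.{u} O₁ O₃ where
  names A hA := h'.names A (h.names A hA)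
  model D I hI := h.model D I (h'.model D I hI)
  expand D I hI := by
    obtain ⟨J, hJ, hIJ⟩ := h.expand D I hI
    obtain ⟨K, hK, hJK⟩ := h'.expand D J hJ
    refine ⟨K, hK, hJK.roleI_eq.trans hIJ.roleI_eq, hJK.indI_eq.trans hIJ.indI_eq,
      fun A hA => (hJK.atomI_eq A ?_).trans (hIJ.atomI_eq A ?_)⟩
    · exact fun hn => hA ⟨hn.1, fun h₁ => hn.2 (h.names A h₁)⟩
    · exact fun hn => hA ⟨h'.names A hn.1, hn.2⟩

lemma OntStep.modelConservative {O O' : Finset Ax} (h : OntStep O O') :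
    ModelConservative.{u} O O' := by
  obtain ⟨A, C, ax, ax', hax, hrep, hfresh⟩ := h
  refine ⟨?_, ?_, ?_⟩
  · rintro B ⟨b, hb, hB⟩
    by_cases hbax : b = ax
    · subst hbax
      rcases Finset.mem_union.mp (hrep.names_subset_union hB) with hB | hB
      · exact ⟨ax', by simp, hB⟩
      · exact ⟨.sub (.atom A) C, by simp, Finset.mem_union_right _ hB⟩
    · exact ⟨b, by simp [hb, hbax], hB⟩
  · intro D I hI b hb
    have hA : I.atomI A = I.sem C :=
      Set.Subset.antisymm (hI (.sub (.atom A) C) (by simp)) (hI (.sub C (.atom A)) (by simp))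
    by_cases hbax : b = ax
    · subst hbax
      exact (hrep.satAx_iff I hA).mp (hI ax' (by simp))
    · exact hI b (by simp [hb, hbax])
  · intro D I hI
    let J : Interp D := { I with atomI := Function.update I.atomI A (I.sem C) }
    have hne : ∀ B, B ≠ A → J.atomI B = I.atomI B := fun B hB => Function.update_of_ne hB _ _
    have hC : J.sem C = I.sem C := sem_congr (I := I) (J := J) rfl C fun B hB =>
      hne B fun hBA => hfresh ax hax (hBA ▸ hrep.conceptNames_subset hB)
    have hA : J.atomI A = J.sem C := (Function.update_self _ _ _).trans hC.symm
    have hJ : ∀ b ∈ O, J.satAx b := fun b hb =>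
      (satAx_congr (I := I) (J := J) rfl rfl b fun B hB =>
        hne B fun hBA => hfresh b hb (hBA ▸ hB)).mpr (hI b hb)
    refine ⟨J, ?_, rfl, rfl, fun B hB => hne B ?_⟩
    · intro b hb
      simp only [Finset.mem_insert, Finset.mem_erase] at hb
      rcases hb with rfl | rfl | rfl | ⟨-, hb⟩
      · exact (hrep.satAx_iff J hA).mpr (hJ ax hax)
      · exact hA.subset
      · exact hA.symm.subset
      · exact hJ b hb
    · rintro rfl
      exact hB ⟨⟨.sub (.atom B) C, by simp, by simp [axNames, conceptNames]⟩,
        fun ⟨b, hb, hBb⟩ => hfresh b hb hBb⟩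

lemma modelConservative_of_reflTransGen {O O' : Finset Ax}
    (h : Relation.ReflTransGen OntStep O O') : ModelConservative.{u} O O' := by
  induction h with
  | refl => exact .refl O
  | tail _ hstep ih => exact ih.trans hstep.modelConservative

/-- let `O` be an ALCι_L ontology and `O'` be obtained from `O`
by repeatedly applying the replacement step until no local definite
descriptions remain (so that `O'` is an ALCι_G ontology).  Then:
(i) every model of `O'` is a model of `O`;
(ii) every model of `O` can be turned into a model of `O'` by changing only
the extensions of the fresh atomic concept names (those occurring in `O'` but
not in `O`); consequently
(iii) `O` is satisfiable iff `O'` is satisfiable, and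
(iv) `O'` is a conservative extension of `O`: an axiom whose atomic concept
names all occur in `O` is entailed by `O'` iff it is entailed by `O`. -/
theorem stmt1 (O O' : Finset Ax)
    (hO : ∀ ax ∈ O, axNoG ax)
    (hsteps : Relation.ReflTransGen OntStep O O')
    (hO' : ∀ ax ∈ O', axNoL ax) :
    (∀ (D : Type u) [Nonempty D] (I : Interp D),
      (∀ ax ∈ O', I.satAx ax) → (∀ ax ∈ O, I.satAx ax)) ∧
    (∀ (D : Type u) [Nonempty D] (I : Interp D), (∀ ax ∈ O, I.satAx ax) →
      ∃ I' : Interp D, (∀ ax ∈ O', I'.satAx ax) ∧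
        I'.roleI = I.roleI ∧ I'.indI = I.indI ∧
        ∀ A : ℕ, ¬((∃ ax ∈ O', A ∈ axNames ax) ∧ ∀ ax ∈ O, A ∉ axNames ax) →
          I'.atomI A = I.atomI A) ∧
    ((∃ (D : Type u) (_ : Nonempty D) (I : Interp D), ∀ ax ∈ O, I.satAx ax) ↔
      (∃ (D : Type u) (_ : Nonempty D) (I : Interp D), ∀ ax ∈ O', I.satAx ax)) ∧
    (∀ ax : Ax, (∀ A ∈ axNames ax, ∃ b ∈ O, A ∈ axNames b) →
      ((∀ (D : Type u) [Nonempty D] (I : Interp D),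
          (∀ b ∈ O', I.satAx b) → I.satAx ax) ↔
        (∀ (D : Type u) [Nonempty D] (I : Interp D),
          (∀ b ∈ O, I.satAx b) → I.satAx ax))) := by
  have h := modelConservative_of_reflTransGen.{u} hsteps
  refine ⟨fun D _ => h.model D, fun D _ I hI => ?_, ⟨?_, ?_⟩, fun ax hax => ⟨?_, ?_⟩⟩
  · obtain ⟨J, hJ, hIJ⟩ := h.expand D I hI
    exact ⟨J, hJ, hIJ.roleI_eq, hIJ.indI_eq, fun A hA =>
      hIJ.atomI_eq A fun hn => hA ⟨hn.1, fun b hb hAb => hn.2 ⟨b, hb, hAb⟩⟩⟩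
  · rintro ⟨D, hD, I, hI⟩
    obtain ⟨J, hJ, -⟩ := h.expand D I hI
    exact ⟨D, hD, J, hJ⟩
  · rintro ⟨D, hD, I, hI⟩
    exact ⟨D, hD, I, h.model D I hI⟩
  · intro hent D _ I hI
    obtain ⟨J, hJ, hIJ⟩ := h.expand D I hI
    exact (satAx_congr hIJ.roleI_eq hIJ.indI_eq ax fun A hA =>
      hIJ.atomI_eq A fun hn => hn.2 (hax A hA)).mp (hent D J hJ)
  · intro hent D _ I hI
    exact hent D I (h.model D I hI)

end DL
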